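/- arXiv:1702.00446 — 2 statements merged into one kernel-verified Lean document; each statement's English description precedes it below -/
import Mathlib

section
/- Let K be a simplicial complex on the vertex set [m], and let (S¹)^K = { x ∈ (S¹)^m : there exists a face I ∈ K with x_k = 1 for all k ∉ I } be the polyhedral product subspace of the m-torus (S¹)^m, with basepoint the constant point (1, …, 1). Then the fundamental group of (S¹)^K is isomorphic to the right-angled Artin group RAAG_K. -/
/-- The relators of the right-angled Artin group of a simplicial complex `K` on `m` vertices:
the commutators `[gᵢ, gⱼ]` for all edges `{i, j}` of `K`. -/
def raagRels (m : ℕ) (K : Finset (Finset (Fin m))) : Set (FreeGroup (Fin m)) :=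
  { r | ∃ i j : Fin m, i ≠ j ∧ ({i, j} : Finset (Fin m)) ∈ K ∧
      r = (FreeGroup.of i)⁻¹ * (FreeGroup.of j)⁻¹ * FreeGroup.of i * FreeGroup.of j }

/-- The right-angled Artin group `RAAG_K`. -/
abbrev RAAG (m : ℕ) (K : Finset (Finset (Fin m))) : Type := PresentedGroup (raagRels m K)

/-- The polyhedral product `(S¹)^K ⊆ (S¹)^m`: the subspace of the `m`-torus consisting of
points `x` for which there is a face `I ∈ K` with `x_k = 1` for all `k ∉ I`. -/
abbrev circlePolyhedralProduct (m : ℕ) (K : Finset (Finset (Fin m))) : Type :=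
  { x : Fin m → Circle // ∃ I ∈ K, ∀ k, k ∉ I → x k = 1 }

noncomputable section

namespace CirclePolyhedralProduct

open Complex (arg)
open Real (pi)

/-- The point removed from the circle on which the branch `cutAngle b` of the angle is
continuous. -/
def cutPoint (b : Bool) : Circle := if b then 1 else -1

/-- The number of full turns by which `cutAngle b` differs from the principal argument. -/
def cutIndex (b : Bool) (z : Circle) : ℤ := if b ∧ arg z < 0 then 1 else 0

/-- The branch of the angle with values in `(-π, π]` if `b` is false, in `[0, 2π)` otherwise. -/
def cutAngle (b : Bool) (z : Circle) : ℝ := arg z + cutIndex b z * (2 * pi)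

lemma neg_one_ne_one : (-1 : Circle) ≠ 1 := by
  intro h
  have := congrArg (fun z : Circle => (z : ℂ).re) h
  norm_num at this

lemma exp_cutAngle (b : Bool) (z : Circle) : Circle.exp (cutAngle b z) = z := by
  rw [cutAngle, Circle.exp_add, Circle.exp_arg, Circle.exp_int_mul_two_pi, mul_one]

@[simp]
lemma cutIndex_one (b : Bool) : cutIndex b 1 = 0 := by simp [cutIndex]

@[simp]
lemma cutAngle_one (b : Bool) : cutAngle b 1 = 0 := by simp [cutAngle]

lemma cutAngle_true {z : Circle} (hz : z ≠ 1) : cutAngle true z = arg (-z : ℂ) + pi := by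
  rcases lt_trichotomy (z : ℂ).im 0 with h | h | h
  · rw [Complex.arg_neg_eq_arg_add_pi_of_im_neg h]
    simp [cutAngle, cutIndex, Complex.arg_neg_iff.2 h]
    ring
  · have h1 : z = -1 := by
      have hn := Circle.normSq_coe z
      rw [Complex.normSq_apply, h] at hn
      have : ((z : ℂ).re - 1) * ((z : ℂ).re + 1) = 0 := by linarith
      rcases mul_eq_zero.1 this with h' | h'
      · refine absurd (Circle.ext (Complex.ext ?_ ?_)) hz
        · simp; linarith
        · simp [h]
      · refine Circle.ext (Complex.ext ?_ ?_)
        · simp; linarith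
        · simp [h]
    subst h1
    simp [cutAngle, cutIndex, Real.pi_pos.le]
  · rw [Complex.arg_neg_eq_arg_sub_pi_of_im_pos h]
    have : ¬ arg (z : ℂ) < 0 := by rw [Complex.arg_neg_iff]; linarith
    simp [cutAngle, cutIndex, this]

lemma mem_slitPlane_of_ne {z : Circle} (hz : z ≠ -1) : (z : ℂ) ∈ Complex.slitPlane := by
  rw [Complex.mem_slitPlane_iff_arg]
  refine ⟨fun h => hz ?_, Circle.coe_ne_zero z⟩
  rw [← Circle.exp_arg z, h]
  ext
  simp

lemma continuousAt_cutAngle {b : Bool} {z : Circle} (hz : z ≠ cutPoint b) :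
    ContinuousAt (cutAngle b) z := by
  cases b with
  | false =>
    have h : cutAngle false = fun z : Circle => arg z := by
      funext z; simp [cutAngle, cutIndex]
    rw [h]
    exact (Complex.continuousAt_arg (mem_slitPlane_of_ne (by simpa [cutPoint] using hz))).comp
      (continuous_subtype_val (p := (· ∈ Submonoid.unitSphere ℂ))).continuousAt
  | true =>
    have hz1 : z ≠ 1 := by simpa [cutPoint] using hz
    have h : cutAngle true =ᶠ[nhds z] fun z : Circle => arg ((-z : Circle) : ℂ) + pi := by
      filter_upwards [isOpen_ne.mem_nhds hz1] with w hw
      simpa using cutAngle_true hw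
    refine ContinuousAt.congr ?_ h.symm
    refine ContinuousAt.add ?_ continuousAt_const
    exact ContinuousAt.comp (f := fun z : Circle => ((-z : Circle) : ℂ))
      (Complex.continuousAt_arg (mem_slitPlane_of_ne fun h => hz1 (neg_injective h)))
      ((continuous_subtype_val (p := (· ∈ Submonoid.unitSphere ℂ))).comp
        (continuous_neg (G := Circle))).continuousAt

/-- The number of full turns from the branch `cutAngle b` to the real number `v`. -/
def turns (b : Bool) (v : ℝ) : ℤ :=
  toIocDiv Real.two_pi_pos (-pi) v - cutIndex b (Circle.exp v)

lemma arg_exp_add (v : ℝ) :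
    arg (Circle.exp v) + toIocDiv Real.two_pi_pos (-pi) v * (2 * pi) = v := by
  rw [Circle.coe_exp, Complex.arg_exp_mul_I]
  simp

lemma turns_mul (b : Bool) (v : ℝ) :
    (turns b v : ℝ) * (2 * pi) = v - cutAngle b (Circle.exp v) := by
  have := arg_exp_add v
  rw [turns, cutAngle, Int.cast_sub]
  linarith

lemma turns_int (b : Bool) (n : ℤ) : turns b (n * (2 * pi)) = n := by
  have h := turns_mul b (n * (2 * pi))
  rw [Circle.exp_int_mul_two_pi, cutAngle_one, sub_zero] at h
  exact_mod_cast mul_right_cancel₀ Real.two_pi_pos.ne' h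

@[simp]
lemma turns_zero (b : Bool) : turns b 0 = 0 := by simpa using turns_int b 0

lemma continuousWithinAt_of_mul_two_pi {Y : Type*} [TopologicalSpace Y] {f : Y → ℤ} {s : Set Y}
    {y : Y} (h : ContinuousWithinAt (fun y => (f y : ℝ) * (2 * pi)) s y) :
    ContinuousWithinAt f s y := by
  rw [Int.isClosedEmbedding_coe_real.isInducing.continuousWithinAt_iff]
  refine (h.div_const (2 * pi)).congr (fun z _ => ?_) ?_ <;> simp

/-- The product of the powers `g k ^ n k`, in the order of the indices. -/
def orderedProd {m : ℕ} {G : Type*} [Group G] (g : Fin m → G) (n : Fin m → ℤ) : G :=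
  ((List.finRange m).map fun k => g k ^ n k).prod

section orderedProd

variable {m : ℕ} {G : Type*} [Group G] (g : Fin m → G)

lemma orderedProd_add {n n' : Fin m → ℤ}
    (h : ∀ i j, i ≠ j → n i ≠ 0 → n' j ≠ 0 → Commute (g i) (g j)) :
    orderedProd g (n + n') = orderedProd g n * orderedProd g n' := by
  have hc : ∀ i j, Commute (g i ^ n i) (g j ^ n' j) := by
    intro i j
    by_cases hij : i = j
    · subst hij; exact (Commute.refl _).zpow_zpow _ _
    by_cases hi : n i = 0
    · simp [hi]
    by_cases hj : n' j = 0
    · simp [hj]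
    exact (h i j hij hi hj).zpow_zpow _ _
  unfold orderedProd
  induction List.finRange m with
  | nil => simp
  | cons a l ih =>
    have : Commute (g a ^ n' a) (l.map fun k => g k ^ n k).prod := by
      refine Commute.list_prod_right _ _ fun x hx => ?_
      obtain ⟨k, -, rfl⟩ := List.mem_map.1 hx
      exact (hc k a).symm
    rw [List.map_cons, List.map_cons, List.map_cons, List.prod_cons, List.prod_cons,
      List.prod_cons, ih, Pi.add_apply, zpow_add, mul_assoc, mul_assoc,
      ← mul_assoc (g a ^ n' a), this.eq, mul_assoc]

@[simp]
lemma orderedProd_zero : orderedProd g 0 = 1 := by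
  simp [orderedProd]

lemma orderedProd_single (i : Fin m) : orderedProd g (Pi.single i 1) = g i := by
  rw [orderedProd, List.prod_map_eq_pow_single i]
  · simp
  · intro a ha _
    simp [ha]

end orderedProd

section Charts

variable {m : ℕ} {K : Finset (Finset (Fin m))}

/-- The open set of points whose coordinates avoid the cut points prescribed by `I`. -/
def chart (K : Finset (Finset (Fin m))) (I : Fin m → Bool) :
    Set (circlePolyhedralProduct m K) :=
  { x | ∀ k, x.1 k ≠ cutPoint (I k) }

lemma isOpen_chart (I : Fin m → Bool) : IsOpen (chart K I) := by
  simp only [chart, Set.ofPred_forall]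
  exact isOpen_iInter_of_finite fun k =>
    isOpen_ne.preimage ((continuous_apply k).comp continuous_subtype_val)

open Classical in
/-- A choice of a chart around each point. -/
def chartAt (x : circlePolyhedralProduct m K) : Fin m → Bool :=
  fun k => decide (x.1 k = -1)

lemma mem_chartAt (x : circlePolyhedralProduct m K) : x ∈ chart K (chartAt x) := by
  intro k
  by_cases h : x.1 k = -1
  · simp [chartAt, cutPoint, h, neg_one_ne_one]
  · simp [chartAt, cutPoint, h]

lemma continuousAt_cutAngle_coord {I : Fin m → Bool} {x : circlePolyhedralProduct m K}
    (hx : x ∈ chart K I) (k : Fin m) :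
    ContinuousAt (fun y : circlePolyhedralProduct m K => cutAngle (I k) (y.1 k)) x :=
  ContinuousAt.comp (f := fun y : circlePolyhedralProduct m K => y.1 k)
    (continuousAt_cutAngle (hx k))
    ((continuous_apply k).comp continuous_subtype_val).continuousAt

/-- The difference of the branches of the angle given by two charts, in full turns. -/
def transition (I J : Fin m → Bool) (x : Fin m → Circle) : Fin m → ℤ :=
  fun k => cutIndex (I k) (x k) - cutIndex (J k) (x k)

lemma continuousOn_transition (I J : Fin m → Bool) :
    ContinuousOn (fun x : circlePolyhedralProduct m K => transition I J x.1)
      (chart K I ∩ chart K J) := by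
  intro x hx
  refine continuousWithinAt_pi.2 fun k => continuousWithinAt_of_mul_two_pi ?_
  have h := ((continuousAt_cutAngle_coord hx.1 k).sub
    (continuousAt_cutAngle_coord hx.2 k)).continuousWithinAt (s := chart K I ∩ chart K J)
  refine h.congr (fun y _ => ?_) ?_ <;>
  · simp only [transition, cutAngle, Int.cast_sub, Pi.sub_apply]
    ring

/-- Elements indexed by the ends of an edge of `K` commute. -/
def CommuteOnEdges {G : Type*} [Group G] (K : Finset (Finset (Fin m))) (g : Fin m → G) : Prop :=
  ∀ i j, i ≠ j → {i, j} ∈ K → Commute (g i) (g j)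

lemma CommuteOnEdges.orderedProd_add {G : Type*} [Group G] {g : Fin m → G}
    (hg : CommuteOnEdges K g) (hdown : ∀ I ∈ K, ∀ J ⊆ I, J ∈ K) {S : Finset (Fin m)}
    (hS : S ∈ K) {n n' : Fin m → ℤ} (hn : ∀ k ∉ S, n k = 0) (hn' : ∀ k ∉ S, n' k = 0) :
    orderedProd g (n + n') = orderedProd g n * orderedProd g n' := by
  refine CirclePolyhedralProduct.orderedProd_add g fun i j hij hi hj => hg i j hij ?_
  refine hdown S hS _ fun k hk => ?_
  rcases Finset.mem_insert.1 hk with rfl | hk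
  · exact not_imp_comm.1 (hn k) hi
  · rw [Finset.mem_singleton.1 hk]
    exact not_imp_comm.1 (hn' j) hj

/-- The principal bundle over `(S¹)^K` with discrete structure group `G` in which the loop around
the `k`-th circle acts as the multiplication by `g k`. -/
def bundleCore (hdown : ∀ I ∈ K, ∀ J ⊆ I, J ∈ K) {G : Type*} [Group G] [TopologicalSpace G]
    [DiscreteTopology G] {g : Fin m → G} (hg : CommuteOnEdges K g) :
    FiberBundleCore (Fin m → Bool) (circlePolyhedralProduct m K) G where
  baseSet := chart K
  isOpen_baseSet := isOpen_chart
  indexAt := chartAt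
  mem_baseSet_at := mem_chartAt
  coordChange I J x h := orderedProd g (transition I J x.1) * h
  coordChange_self I x _ h := by
    have : transition I I x.1 = 0 := by funext k; simp [transition]
    rw [this, orderedProd_zero, one_mul]
  continuousOn_coordChange I J := by
    have h : Continuous fun p : (Fin m → ℤ) × G => orderedProd g p.1 * p.2 :=
      continuous_of_discreteTopology
    refine h.comp_continuousOn (ContinuousOn.prodMk ?_ continuous_snd.continuousOn)
    exact (continuousOn_transition I J).comp continuous_fst.continuousOn fun p hp => hp.1
  coordChange_comp I J L x _ h := by
    obtain ⟨S, hS, hx⟩ := x.2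
    have h0 : ∀ (I J : Fin m → Bool), ∀ k ∉ S, transition I J x.1 k = 0 := fun I J k hk => by
      simp [transition, hx k hk]
    rw [← mul_assoc, ← hg.orderedProd_add hdown hS (h0 J L) (h0 I J)]
    congr 2
    funext k
    simp [transition]

end Charts

section PathLift

variable {m : ℕ} {K : Finset (Finset (Fin m))}

/-- The path `p` lifts to a path from `u` to `v` in the coordinate subspace of `ℝ^m` spanned by
the directions in `S`. -/
def PathLift (S : Finset (Fin m)) {x y : circlePolyhedralProduct m K} (p : Path x y)
    (u v : Fin m → ℝ) : Prop :=
  ∃ P : Path u v, ∀ t k, (k ∉ S → P t k = 0) ∧ (p t).1 k = Circle.exp (P t k)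

lemma monodromy_of_pathLift (hdown : ∀ I ∈ K, ∀ J ⊆ I, J ∈ K) {G : Type*} [Group G]
    [TopologicalSpace G] [DiscreteTopology G] {g : Fin m → G} (hg : CommuteOnEdges K g)
    {S : Finset (Fin m)} (hS : S ∈ K) {x y : circlePolyhedralProduct m K} {p : Path x y}
    {u v : Fin m → ℝ} (hp : PathLift S p u v) (h : G) :
    ((FiberBundle.isCoveringMap (F := G) (E := (bundleCore hdown hg).Fiber)).monodromy
      (Path.Homotopic.Quotient.mk p)
        ⟨⟨x, (orderedProd g (fun k => turns (chartAt x k) (u k)) * h : G)⟩, rfl⟩).1 =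
        ⟨y, (orderedProd g (fun k => turns (chartAt y k) (v k)) * h : G)⟩ := by
  obtain ⟨P, hP⟩ := hp
  let Z := bundleCore hdown hg
  let c : unitInterval → Z.TotalSpace := fun t =>
    ⟨p t, (orderedProd g (fun k => turns (chartAt (p t) k) (P t k)) * h : G)⟩
  have hc : Continuous c := by
    refine continuous_iff_continuousAt.2 fun t₀ => ?_
    refine (FiberBundle.continuousAt_totalSpace G c).2 ⟨p.continuous.continuousAt, ?_⟩
    have key : (fun t => (trivializationAt G Z.Fiber (c t₀).proj (c t)).2) =
        fun t => orderedProd g (fun k => turns (chartAt (p t₀) k) (P t k)) * h := by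
      funext t
      change orderedProd g (transition (chartAt (p t)) (chartAt (p t₀)) (p t).1) *
        (orderedProd g (fun k => turns (chartAt (p t) k) (P t k)) * h) = _
      rw [← mul_assoc, ← hg.orderedProd_add hdown hS]
      · congr 2
        funext k
        simp only [Pi.add_apply, transition, turns, (hP t k).2]
        ring
      · intro k hk
        simp [transition, (hP t k).2, (hP t k).1 hk]
      · intro k hk
        simp [(hP t k).1 hk]
    rw [key]
    have hd : Continuous fun n : Fin m → ℤ => orderedProd g n * h :=
      continuous_of_discreteTopology
    refine hd.continuousAt.comp (continuousAt_pi.2 fun k => ?_)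
    rw [← continuousWithinAt_univ]
    refine continuousWithinAt_of_mul_two_pi ?_
    rw [continuousWithinAt_univ]
    have h1 : ContinuousAt (fun t => P t k) t₀ :=
      ((continuous_apply k).comp P.continuous).continuousAt
    have h2 : ContinuousAt (fun t => cutAngle (chartAt (p t₀) k) ((p t).1 k)) t₀ :=
      ContinuousAt.comp (f := p) (continuousAt_cutAngle_coord (mem_chartAt (p t₀)) k)
        p.continuous.continuousAt
    refine (h1.sub h2).congr (Filter.Eventually.of_forall fun t => ?_)
    simp only [turns_mul, (hP t k).2, Pi.sub_apply]
  let Γ : Path (⟨x, (orderedProd g (fun k => turns (chartAt x k) (u k)) * h : G)⟩ : Z.TotalSpace)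
      ⟨y, (orderedProd g (fun k => turns (chartAt y k) (v k)) * h : G)⟩ :=
    { toFun := c
      continuous_toFun := hc
      source' := by
        simp only [c, P.source]
        rw [p.source]
      target' := by
        simp only [c, P.target]
        rw [p.target] }
  exact congrArg Subtype.val
    ((FiberBundle.isCoveringMap (F := G) (E := Z.Fiber)).monodromy_eq_of_map_eq
      (γ := Path.Homotopic.Quotient.mk p) (ex := ⟨_, rfl⟩) (ey := ⟨_, rfl⟩)
      (Path.Homotopic.Quotient.mk Γ) rfl)

namespace PathLift

variable {S : Finset (Fin m)} {x y z : circlePolyhedralProduct m K} {p : Path x y}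
  {u v w : Fin m → ℝ}

lemma target_eq_zero (hp : PathLift S p u v) {k : Fin m} (hk : k ∉ S) : v k = 0 := by
  obtain ⟨P, hP⟩ := hp
  simpa using (hP 1 k).1 hk

lemma trans {q : Path y z} (hp : PathLift S p u v) (hq : PathLift S q v w) :
    PathLift S (p.trans q) u w := by
  obtain ⟨P, hP⟩ := hp
  obtain ⟨Q, hQ⟩ := hq
  refine ⟨P.trans Q, fun t k => ?_⟩
  simp only [Path.trans_apply]
  split_ifs
  exacts [hP _ k, hQ _ k]

lemma symm (hp : PathLift S p u v) : PathLift S p.symm v u := by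
  obtain ⟨P, hP⟩ := hp
  exact ⟨P.symm, fun t k => hP _ k⟩

lemma add (hp : PathLift S p u v) (hw : ∀ k ∉ S, w k = 0) (hw' : ∀ k, Circle.exp (w k) = 1) :
    PathLift S p (u + w) (v + w) := by
  obtain ⟨P, hP⟩ := hp
  refine ⟨⟨⟨fun t => P t + w, by fun_prop⟩, by simp, by simp⟩, fun t k => ⟨fun hk => ?_, ?_⟩⟩
  · simp [(hP t k).1 hk, hw k hk]
  · simp [(hP t k).2, Circle.exp_add, hw' k]

lemma homotopic (hS : S ∈ K) {q : Path x y} (hp : PathLift S p u v) (hq : PathLift S q u v) :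
    p.Homotopic q := by
  obtain ⟨P, hP⟩ := hp
  obtain ⟨Q, hQ⟩ := hq
  refine ⟨⟨⟨⟨fun r => ⟨fun k => Circle.exp ((1 - r.1) * P r.2 k + r.1 * Q r.2 k), S, hS,
    fun k hk => ?_⟩, ?_⟩, fun t => ?_, fun t => ?_⟩, fun r t ht => ?_⟩⟩
  · simp [(hP r.2 k).1 hk, (hQ r.2 k).1 hk]
  · refine Continuous.subtype_mk (continuous_pi fun k => Circle.exp.continuous.comp ?_) _
    have h1 : Continuous fun t => P t k := (continuous_apply k).comp P.continuous
    have h2 : Continuous fun t => Q t k := (continuous_apply k).comp Q.continuous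
    fun_prop
  · refine Subtype.ext (funext fun k => ?_)
    simp [(hP t k).2]
  · refine Subtype.ext (funext fun k => ?_)
    simp [(hQ t k).2]
  · refine Subtype.ext (funext fun k => ?_)
    rcases ht with rfl | rfl
    · have := (hP 0 k).2
      simp only [Path.source] at this
      simp [this, ← add_mul, -Circle.exp_add]
    · have := (hP 1 k).2
      simp only [Path.target] at this
      simp [this, ← add_mul, -Circle.exp_add]

lemma exists_path (hS : S ∈ K) (hu : ∀ k ∉ S, u k = 0) (hv : ∀ k ∉ S, v k = 0)
    (hx : ∀ k, x.1 k = Circle.exp (u k)) (hy : ∀ k, y.1 k = Circle.exp (v k)) :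
    ∃ p : Path x y, PathLift S p u v := by
  let P : Path u v := ⟨⟨fun t k => u k + t * (v k - u k), by fun_prop⟩, by simp, by simp⟩
  have hP : ∀ t, ∀ k ∉ S, P t k = 0 := fun t k hk => by simp [P, hu k hk, hv k hk]
  refine ⟨⟨⟨fun t => ⟨fun k => Circle.exp (P t k), S, hS, fun k hk => by simp [hP t k hk]⟩, ?_⟩,
    ?_, ?_⟩, P, fun t k => ⟨hP t k, rfl⟩⟩
  · exact Continuous.subtype_mk (continuous_pi fun k =>
      Circle.exp.continuous.comp ((continuous_apply k).comp P.continuous)) _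
  · exact Subtype.ext (funext fun k => by simp [hx])
  · exact Subtype.ext (funext fun k => by simp [hy])

end PathLift

end PathLift

section Generation

variable {m : ℕ} {K : Finset (Finset (Fin m))}

/-- The point all of whose coordinates are `1`. -/
def base (hempty : ∅ ∈ K) : circlePolyhedralProduct m K :=
  ⟨fun _ => 1, ∅, hempty, fun _ _ => rfl⟩

/-- The vector of angles corresponding to a vector of numbers of full turns. -/
def turnAngle (n : Fin m → ℤ) : Fin m → ℝ := fun k => n k * (2 * pi)

lemma exp_turnAngle (n : Fin m → ℤ) (k : Fin m) : Circle.exp (turnAngle n k) = 1 :=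
  Circle.exp_int_mul_two_pi _

@[simp]
lemma turnAngle_zero : turnAngle (0 : Fin m → ℤ) = 0 := by
  funext k; simp [turnAngle]

lemma turnAngle_add (n n' : Fin m → ℤ) : turnAngle (n + n') = turnAngle n + turnAngle n' := by
  funext k; simp [turnAngle, add_mul]

lemma turnAngle_neg (n : Fin m → ℤ) : turnAngle (-n) = -turnAngle n := by
  funext k; simp [turnAngle]

variable {hempty : ∅ ∈ K}

lemma exists_loop {S : Finset (Fin m)} (hS : S ∈ K) {n : Fin m → ℤ} (hn : ∀ k ∉ S, n k = 0) :
    ∃ p : Path (base hempty) (base hempty), PathLift S p 0 (turnAngle n) :=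
  PathLift.exists_path hS (fun _ _ => rfl) (fun k hk => by simp [turnAngle, hn k hk])
    (fun k => by simp [base]) fun k => by simp [base, exp_turnAngle]

lemma PathLift.trans_loop {S : Finset (Fin m)} {y : circlePolyhedralProduct m K}
    {p : Path (base hempty) (base hempty)} {q : Path (base hempty) y} {n : Fin m → ℤ}
    {v : Fin m → ℝ} (hp : PathLift S p 0 (turnAngle n)) (hq : PathLift S q 0 v) :
    PathLift S (p.trans q) 0 (v + turnAngle n) := by
  refine hp.trans ?_
  simpa using hq.add (w := turnAngle n) (fun k hk => hp.target_eq_zero hk) (exp_turnAngle n)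

lemma PathLift.symm_loop {S : Finset (Fin m)} {p : Path (base hempty) (base hempty)}
    {n : Fin m → ℤ} (hp : PathLift S p 0 (turnAngle n)) :
    PathLift S p.symm 0 (turnAngle (-n)) := by
  have h := hp.symm.add (w := turnAngle (-n))
    (fun k hk => by simpa [turnAngle_neg] using hp.target_eq_zero hk) (exp_turnAngle _)
  simpa [turnAngle_neg] using h

/-- The class of a loop in the fundamental group. -/
abbrev loopClass (p : Path (base hempty) (base hempty)) :
    FundamentalGroup (circlePolyhedralProduct m K) (base hempty) :=
  FundamentalGroup.fromPath (Path.Homotopic.Quotient.mk p)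

/-- The subgroup `H` contains loops around all the circles. -/
def ContainsCircles
    (H : Subgroup (FundamentalGroup (circlePolyhedralProduct m K) (base hempty))) : Prop :=
  ∀ k : Fin m, ∃ p : Path (base hempty) (base hempty),
    PathLift {k} p 0 (turnAngle (Pi.single k 1)) ∧ loopClass p ∈ H

variable {H : Subgroup (FundamentalGroup (circlePolyhedralProduct m K) (base hempty))}

lemma PathLift.mono {S T : Finset (Fin m)} {x y : circlePolyhedralProduct m K} {p : Path x y}
    {u v : Fin m → ℝ} (hST : S ⊆ T) (hp : PathLift S p u v) : PathLift T p u v := by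
  obtain ⟨P, hP⟩ := hp
  exact ⟨P, fun t k => ⟨fun hk => (hP t k).1 fun h => hk (hST h), (hP t k).2⟩⟩

lemma ContainsCircles.mem (hH : ContainsCircles H) {S : Finset (Fin m)} (hS : S ∈ K)
    {p : Path (base hempty) (base hempty)} {n : Fin m → ℤ} (hp : PathLift S p 0 (turnAngle n)) :
    loopClass p ∈ H := by
  let A : AddSubgroup (Fin m → ℤ) :=
    { carrier := { n | ∃ p : Path (base hempty) (base hempty),
        PathLift S p 0 (turnAngle n) ∧ loopClass p ∈ H }
      zero_mem' := by
        refine ⟨Path.refl _, ⟨(Path.refl _).cast rfl turnAngle_zero, fun t k => ⟨fun _ => rfl, ?_⟩⟩, H.one_mem⟩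
        exact Circle.exp_zero.symm
      add_mem' := by
        rintro n n' ⟨p, hp, hpH⟩ ⟨q, hq, hqH⟩
        refine ⟨q.trans p, ?_, H.mul_mem hpH hqH⟩
        rw [turnAngle_add]
        exact hq.trans_loop hp
      neg_mem' := by
        rintro n ⟨p, hp, hpH⟩
        exact ⟨p.symm, hp.symm_loop, H.inv_mem hpH⟩ }
  have hn : n ∈ A := by
    have : n = ∑ k, n k • (Pi.single k 1 : Fin m → ℤ) := by
      funext j
      simp [Finset.sum_apply, Pi.single_apply]
    rw [this]
    refine A.sum_mem fun k _ => ?_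
    by_cases hk : k ∈ S
    · obtain ⟨p, hp, hpH⟩ := hH k
      exact A.zsmul_mem ⟨p, hp.mono (by simpa using hk), hpH⟩ _
    · have : n k = 0 := by
        have := hp.target_eq_zero hk
        simpa [turnAngle, Real.pi_ne_zero] using this
      rw [this, zero_smul]
      exact A.zero_mem
  obtain ⟨q, hq, hqH⟩ := hn
  have : Path.Homotopic.Quotient.mk p = Path.Homotopic.Quotient.mk q :=
    Path.Homotopic.Quotient.eq.2 (hp.homotopic hS hq)
  simpa only [loopClass, this] using hqH

/-- The path from the base point to `x` along which the angles of the chart `I` are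
proportional. -/
def ray (hempty : ∅ ∈ K) (I : Fin m → Bool) (x : circlePolyhedralProduct m K) :
    Path (base hempty) x where
  toFun s := ⟨fun k => Circle.exp (s * cutAngle (I k) (x.1 k)), by
    obtain ⟨S, hS, hx⟩ := x.2
    exact ⟨S, hS, fun k hk => by simp [hx k hk]⟩⟩
  continuous_toFun := by
    refine Continuous.subtype_mk (continuous_pi fun k => Circle.exp.continuous.comp ?_) _
    fun_prop
  source' := by simp [base]
  target' := by simp [exp_cutAngle]

lemma ray_base (I : Fin m → Bool) : ray hempty I (base hempty) = Path.refl _ := by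
  refine Path.ext (funext fun t => Subtype.ext (funext fun k => ?_))
  change Circle.exp (t * cutAngle (I k) 1) = 1
  simp

lemma pathLift_ray (I : Fin m → Bool) (x : circlePolyhedralProduct m K) {S : Finset (Fin m)}
    (hx : ∀ k ∉ S, x.1 k = 1) :
    PathLift S (ray hempty I x) 0 fun k => cutAngle (I k) (x.1 k) := by
  refine ⟨⟨⟨fun s k => s * cutAngle (I k) (x.1 k), by fun_prop⟩, ?_, ?_⟩, fun t k => ⟨?_, ?_⟩⟩
  · funext k; simp
  · funext k; simp
  · intro hk; simp [hx k hk]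
  · rfl

lemma ContainsCircles.exists_ray_eq (hH : ContainsCircles H) (I J : Fin m → Bool)
    (x : circlePolyhedralProduct m K) :
    ∃ p : Path (base hempty) (base hempty), loopClass p ∈ H ∧
      (ray hempty I x).Homotopic (p.trans (ray hempty J x)) := by
  obtain ⟨S, hS, hx⟩ := x.2
  obtain ⟨p, hp⟩ := exists_loop (hempty := hempty) hS (n := transition I J x.1)
    fun k hk => by simp [transition, hx k hk]
  refine ⟨p, hH.mem hS hp, (pathLift_ray I x hx).homotopic hS ?_⟩
  convert hp.trans_loop (pathLift_ray J x hx) using 1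
  funext k
  simp only [cutAngle, transition, turnAngle, Pi.add_apply, Int.cast_sub]
  ring

lemma homotopic_of_square {X : Type*} [TopologicalSpace X] {a x y : X} {p : Path a x}
    {q : Path a y} {r : Path x y} (F : C(unitInterval × unitInterval, X))
    (hp : ∀ s, F (s, 0) = p s) (hq : ∀ s, F (s, 1) = q s) (hr : ∀ t, F (1, t) = r t)
    (ha : ∀ t, F (0, t) = a) : (p.trans r).Homotopic q := by
  let id₀₁ : Path (0 : unitInterval) 1 := ⟨⟨id, continuous_id⟩, rfl, rfl⟩
  let P := (id₀₁.prod (Path.refl 0)).trans ((Path.refl 1).prod id₀₁)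
  let Q := ((Path.refl 0).prod id₀₁).trans (id₀₁.prod (Path.refl 1))
  have : ContractibleSpace unitInterval :=
    (convex_Icc (0 : ℝ) 1).contractibleSpace ⟨0, by simp⟩
  have h : P.Homotopic Q := SimplyConnectedSpace.paths_homotopic _ _
  have hx : a = F (0, 0) := (ha 0).symm
  have hy : y = F (1, 1) := by rw [hr]; simp
  have h' := (h.map F).pathCast hx hy
  have hP : (P.map F.continuous).cast hx hy = p.trans r := by
    ext t
    simp only [P, Path.cast_coe, Path.map_coe, Function.comp_apply, Path.trans_apply]
    split_ifs
    · exact hp _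
    · exact hr _
  have hQ : (Q.map F.continuous).cast hx hy = (Path.refl a).trans q := by
    ext t
    simp only [Q, Path.cast_coe, Path.map_coe, Function.comp_apply, Path.trans_apply]
    split_ifs
    · exact ha _
    · exact hq _
  rw [hP, hQ] at h'
  exact h'.trans (Path.Homotopic.refl_trans q)

lemma ray_trans_homotopic {I : Fin m → Bool} {x y : circlePolyhedralProduct m K} (γ : Path x y)
    (hγ : ∀ t, γ t ∈ chart K I) :
    ((ray hempty I x).trans γ).Homotopic (ray hempty I y) := by
  refine homotopic_of_square ⟨fun r => ray hempty I (γ r.2) r.1, ?_⟩ ?_ ?_ ?_ ?_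
  · refine Continuous.subtype_mk (continuous_pi fun k => Circle.exp.continuous.comp ?_) _
    have h : Continuous fun t => cutAngle (I k) ((γ t).1 k) :=
      continuous_iff_continuousAt.2 fun t =>
        ContinuousAt.comp (f := γ) (continuousAt_cutAngle_coord (hγ t) k) γ.continuous.continuousAt
    have h2 : Continuous fun r : unitInterval × unitInterval =>
        cutAngle (I k) ((γ r.2).1 k) := h.comp continuous_snd
    fun_prop
  · intro s
    change ray hempty I (γ 0) s = ray hempty I x s
    rw [γ.source]
  · intro s
    change ray hempty I (γ 1) s = ray hempty I y s
    rw [γ.target]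
  · exact fun t => (ray hempty I (γ t)).target
  · exact fun t => (ray hempty I (γ t)).source

/-- Up to elements of `H`, the path `γ` is determined by its ends. -/
def IsTrivialModulo
    (H : Subgroup (FundamentalGroup (circlePolyhedralProduct m K) (base hempty)))
    {x y : circlePolyhedralProduct m K} (γ : Path x y) : Prop :=
  ∀ I J : Fin m → Bool, ∃ p : Path (base hempty) (base hempty), loopClass p ∈ H ∧
    ((ray hempty I x).trans γ).Homotopic (p.trans (ray hempty J y))

lemma isTrivialModulo_cast {x x' y y' : circlePolyhedralProduct m K} {γ : Path x y}
    {hx : x' = x} {hy : y' = y} : IsTrivialModulo H (γ.cast hx hy) ↔ IsTrivialModulo H γ := by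
  subst hx hy
  rfl

lemma IsTrivialModulo.of_homotopic {x y : circlePolyhedralProduct m K} {γ γ' : Path x y}
    (h : γ.Homotopic γ') (hγ : IsTrivialModulo H γ) : IsTrivialModulo H γ' := by
  intro I J
  obtain ⟨p, hp, hpγ⟩ := hγ I J
  exact ⟨p, hp, ((Path.Homotopic.refl _).hcomp h.symm).trans hpγ⟩

lemma IsTrivialModulo.trans {x y z : circlePolyhedralProduct m K} {γ : Path x y} {γ' : Path y z}
    (hγ : IsTrivialModulo H γ) (hγ' : IsTrivialModulo H γ') :
    IsTrivialModulo H (γ.trans γ') := by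
  intro I J
  obtain ⟨p, hp, h⟩ := hγ I J
  obtain ⟨q, hq, h'⟩ := hγ' J J
  refine ⟨p.trans q, H.mul_mem hq hp, ?_⟩
  simp only [← Path.Homotopic.Quotient.eq, Path.Homotopic.Quotient.mk_trans] at h h' ⊢
  rw [← Path.Homotopic.Quotient.trans_assoc, h, Path.Homotopic.Quotient.trans_assoc, h',
    Path.Homotopic.Quotient.trans_assoc]

lemma ContainsCircles.isTrivialModulo_of_mem_chart (hH : ContainsCircles H) {I : Fin m → Bool}
    {x y : circlePolyhedralProduct m K} (γ : Path x y) (hγ : ∀ t, γ t ∈ chart K I) :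
    IsTrivialModulo H γ := by
  intro I' J'
  obtain ⟨p, hp, h⟩ := hH.exists_ray_eq I' I x
  obtain ⟨q, hq, h'⟩ := hH.exists_ray_eq I J' y
  refine ⟨p.trans q, H.mul_mem hq hp, ?_⟩
  have h'' := ray_trans_homotopic (hempty := hempty) γ hγ
  simp only [← Path.Homotopic.Quotient.eq, Path.Homotopic.Quotient.mk_trans] at h h' h'' ⊢
  rw [h, Path.Homotopic.Quotient.trans_assoc, h'', h', Path.Homotopic.Quotient.trans_assoc]

lemma ContainsCircles.isTrivialModulo (hH : ContainsCircles H)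
    {x y : circlePolyhedralProduct m K} (γ : Path x y) : IsTrivialModulo H γ := by
  obtain ⟨t, ht0, htm, ⟨N, hN⟩, ht⟩ := exists_monotone_Icc_subset_open_cover_unitInterval
    (c := fun I : Fin m → Bool => γ ⁻¹' chart K I)
    (fun I => (isOpen_chart I).preimage γ.continuous)
    (fun s _ => Set.mem_iUnion.2 ⟨_, mem_chartAt (γ s)⟩)
  have key : ∀ n, IsTrivialModulo H (γ.subpath 0 (t n)) := by
    intro n
    induction n with
    | zero =>
      refine hH.isTrivialModulo_of_mem_chart (I := chartAt (γ 0)) _ fun s => ?_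
      have : γ.subpath 0 (t 0) s = γ 0 := by simp [Path.subpath, ht0]
      rw [this]
      exact mem_chartAt _
    | succ n ih =>
      obtain ⟨I, hI⟩ := ht n
      have h : IsTrivialModulo H (γ.subpath (t n) (t (n + 1))) := by
        refine hH.isTrivialModulo_of_mem_chart (I := I) _ fun s => ?_
        have : γ.subpath (t n) (t (n + 1)) s ∈ Set.range (γ.subpath (t n) (t (n + 1))) := ⟨s, rfl⟩
        rw [Path.range_subpath_of_le _ _ _ (htm n.le_succ)] at this
        obtain ⟨r, hr, hrs⟩ := this
        rw [← hrs]
        exact hI hr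
      exact (ih.trans h).of_homotopic ⟨Path.Homotopy.subpathTransSubpath γ 0 (t n) (t (n + 1))⟩
  have h1 := key N
  rw [hN N le_rfl, Path.subpath_zero_one] at h1
  exact isTrivialModulo_cast.1 h1

lemma ContainsCircles.eq_top (hH : ContainsCircles H) : H = ⊤ := by
  refine (Subgroup.eq_top_iff' H).2 fun a => ?_
  obtain ⟨γ, rfl⟩ := Path.Homotopic.Quotient.mk_surjective a
  obtain ⟨p, hp, h⟩ := hH.isTrivialModulo γ (fun _ => false) (fun _ => false)
  rw [ray_base] at h
  simp only [← Path.Homotopic.Quotient.eq, Path.Homotopic.Quotient.mk_trans,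
    Path.Homotopic.Quotient.mk_refl, Path.Homotopic.Quotient.refl_trans,
    Path.Homotopic.Quotient.trans_refl] at h
  rw [h]
  exact hp

end Generation

section Presentation

variable {m : ℕ} {K : Finset (Finset (Fin m))} {hempty : ∅ ∈ K}

lemma commute_loopClass {i j : Fin m} (hij : {i, j} ∈ K)
    {p q : Path (base hempty) (base hempty)}
    (hp : PathLift {i} p 0 (turnAngle (Pi.single i 1)))
    (hq : PathLift {j} q 0 (turnAngle (Pi.single j 1))) :
    Commute (loopClass p) (loopClass q) := by
  have hp' : PathLift {i, j} p 0 (turnAngle (Pi.single i 1)) := hp.mono (by simp)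
  have hq' : PathLift {i, j} q 0 (turnAngle (Pi.single j 1)) := hq.mono (by simp)
  have h := hq'.trans_loop hp'
  rw [add_comm] at h
  exact Path.Homotopic.Quotient.eq.2 (h.homotopic hij (hp'.trans_loop hq'))

lemma commuteOnEdges_of :
    CommuteOnEdges K (PresentedGroup.of : Fin m → RAAG m K) := by
  intro i j hij h
  have h1 : PresentedGroup.mk (raagRels m K) _ = 1 :=
    PresentedGroup.one_of_mem ⟨i, j, hij, h, rfl⟩
  simp only [map_mul, map_inv] at h1
  change (PresentedGroup.of i : RAAG m K)⁻¹ * (PresentedGroup.of j)⁻¹ *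
    PresentedGroup.of i * PresentedGroup.of j = 1 at h1
  rw [← mul_inv_rev, mul_assoc, inv_mul_eq_one] at h1
  exact h1.symm

/-- The homomorphism from the right-angled Artin group sending the generators to the classes
of given loops around the circles. -/
def ofRAAG {p : Fin m → Path (base hempty) (base hempty)}
    (hp : ∀ k, PathLift {k} (p k) 0 (turnAngle (Pi.single k 1))) :
    RAAG m K →* FundamentalGroup (circlePolyhedralProduct m K) (base hempty) :=
  PresentedGroup.toGroup (f := fun k => loopClass (p k)) <| by
    rintro _ ⟨i, j, -, hij, rfl⟩
    have h := commute_loopClass hij (hp i) (hp j)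
    simp only [map_mul, map_inv, FreeGroup.lift_apply_of]
    rw [← mul_inv_rev, mul_assoc, inv_mul_eq_one]
    exact h.symm.eq

variable {p : Fin m → Path (base hempty) (base hempty)}
  (hp : ∀ k, PathLift {k} (p k) 0 (turnAngle (Pi.single k 1)))

lemma ofRAAG_of (k : Fin m) : ofRAAG hp (PresentedGroup.of k) = loopClass (p k) :=
  PresentedGroup.toGroup.of _

lemma ofRAAG_surjective : Function.Surjective (ofRAAG hp) := by
  rw [← MonoidHom.range_eq_top]
  exact ContainsCircles.eq_top fun k => ⟨p k, hp k, PresentedGroup.of k, ofRAAG_of hp k⟩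

lemma ofRAAG_injective (hdown : ∀ I ∈ K, ∀ J ⊆ I, J ∈ K) (hsingle : ∀ i, {i} ∈ K) :
    Function.Injective (ofRAAG hp) := by
  let _ : TopologicalSpace (RAAG m K) := ⊥
  have : DiscreteTopology (RAAG m K) := ⟨rfl⟩
  let Z := bundleCore hdown (commuteOnEdges_of (K := K))
  let cov := FiberBundle.isCoveringMap (F := RAAG m K) (E := Z.Fiber)
  let e (h : RAAG m K) : (Bundle.TotalSpace.proj : Z.TotalSpace → _) ⁻¹' {base hempty} :=
    ⟨⟨base hempty, h⟩, rfl⟩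
  have key : ∀ w h, cov.monodromyPerm _ (ofRAAG hp w) (e h) = e (w * h) := by
    intro w
    have hw : w ∈ Subgroup.closure (Set.range (PresentedGroup.of (rels := raagRels m K))) := by
      rw [PresentedGroup.closure_range_of]
      trivial
    induction hw using Subgroup.closure_induction with
    | mem _ hx =>
      obtain ⟨k, rfl⟩ := hx
      intro h
      have h1 := monodromy_of_pathLift hdown (commuteOnEdges_of (K := K)) (hsingle k) (hp k) h
      have h0 : (fun j => turns (chartAt (base hempty) j) ((0 : Fin m → ℝ) j)) = 0 :=
        funext fun j => turns_zero _
      have h2 : (fun j => turns (chartAt (base hempty) j)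
          (turnAngle (Pi.single k 1) j)) = Pi.single k 1 :=
        funext fun j => turns_int _ _
      rw [h0, h2, orderedProd_zero, orderedProd_single, one_mul] at h1
      rw [ofRAAG_of]
      exact Subtype.ext h1
    | one =>
      intro h
      rw [map_one, map_one, Equiv.Perm.one_apply, one_mul]
    | mul x y _ _ hx hy =>
      intro h
      rw [map_mul, map_mul, Equiv.Perm.mul_apply, hy, hx, mul_assoc]
    | inv x _ hx =>
      intro h
      rw [map_inv, map_inv, Equiv.Perm.inv_eq_iff_eq, hx, mul_inv_cancel_left]
  intro w w' hww
  have h := (key w 1).symm.trans ((congrArg (fun a => cov.monodromyPerm _ a (e 1)) hww).trans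
    (key w' 1))
  rw [mul_one, mul_one] at h
  exact Bundle.TotalSpace.mk_injective (base hempty) (congrArg Subtype.val h)

end Presentation

end CirclePolyhedralProduct

end

/-- The fundamental group of the polyhedral product `(S¹)^K` (based at the constant point
`(1, …, 1)`) is isomorphic to the right-angled Artin group `RAAG_K`. -/
theorem fundamentalGroup_circle_polyhedral_product (m : ℕ) (K : Finset (Finset (Fin m)))
    (hdown : ∀ I ∈ K, ∀ J ⊆ I, J ∈ K) (hempty : (∅ : Finset (Fin m)) ∈ K)
    (hsingle : ∀ i : Fin m, ({i} : Finset (Fin m)) ∈ K) :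
    Nonempty
      (FundamentalGroup (circlePolyhedralProduct m K)
          ⟨fun _ => 1, ∅, hempty, fun _ _ => rfl⟩ ≃* RAAG m K) := by
  choose p hp using fun k : Fin m => CirclePolyhedralProduct.exists_loop (hempty := hempty)
    (hsingle k) (n := Pi.single k 1) fun j hj => Pi.single_eq_of_ne (by simpa using hj) 1
  exact ⟨(MulEquiv.ofBijective (CirclePolyhedralProduct.ofRAAG hp)
    ⟨CirclePolyhedralProduct.ofRAAG_injective hp hdown hsingle,
      CirclePolyhedralProduct.ofRAAG_surjective hp⟩).symm⟩
end

section
/- Let K be a simplicial complex on the vertex set [m], and let L_K = { y ∈ ℝ^m : there exists a face I ∈ K with y_k ∈ ℤ for all k ∉ I } be the polyhedral product subspace of ℝ^m, with basepoint the origin. Then the fundamental group of L_K is isomorphic to the commutator subgroup RAAG_K' = ⁅RAAG_K, RAAG_K⁆ of the right-angled Artin group RAAG_K. -/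
/-- The polyhedral product `L_K = (ℝ, ℤ)^K ⊆ ℝ^m`: the subspace of `ℝ^m` consisting of points
`y` for which there is a face `I ∈ K` with `y_k ∈ ℤ` for all `k ∉ I`. -/
abbrev realPolyhedralProduct (m : ℕ) (K : Finset (Finset (Fin m))) : Type :=
  { y : Fin m → ℝ // ∃ I ∈ K, ∀ k, k ∉ I → ∃ n : ℤ, y k = n }

noncomputable section

open Topology

namespace RAAG

variable {m : ℕ} {K : Finset (Finset (Fin m))}

/-- The standard generators of a right-angled Artin group. -/
def gen (K : Finset (Finset (Fin m))) (i : Fin m) : RAAG m K := PresentedGroup.of i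

theorem commute_gen {i j : Fin m} (hij : i ≠ j) (h : ({i, j} : Finset (Fin m)) ∈ K) :
    Commute (gen K i) (gen K j) := by
  have h1 : PresentedGroup.mk (raagRels m K)
      ((FreeGroup.of i)⁻¹ * (FreeGroup.of j)⁻¹ * FreeGroup.of i * FreeGroup.of j) = 1 :=
    (PresentedGroup.one_of_mem ⟨i, j, hij, h, rfl⟩)
  have h2 : (gen K i)⁻¹ * (gen K j)⁻¹ * gen K i * gen K j = 1 := by
    simpa only [map_mul, map_inv] using! h1
  have h3 : (gen K j * gen K i)⁻¹ * (gen K i * gen K j) = 1 := by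
    rw [← h2]; group
  exact (inv_mul_eq_one.mp h3).symm

/-- A homomorphism out of a right-angled Artin group is given by the images of the generators,
provided that those of adjacent vertices commute. -/
def lift {H : Type*} [Group H] (f : Fin m → H)
    (hf : ∀ i j, i ≠ j → ({i, j} : Finset (Fin m)) ∈ K → Commute (f i) (f j)) : RAAG m K →* H :=
  PresentedGroup.toGroup (f := f) <| by
    rintro r ⟨i, j, hij, h, rfl⟩
    have := (hf i j hij h).eq
    simp only [map_mul, map_inv, FreeGroup.lift_apply_of]
    rw [mul_assoc, this]
    group

@[simp] theorem lift_gen {H : Type*} [Group H] (f : Fin m → H)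
    (hf : ∀ i j, i ≠ j → ({i, j} : Finset (Fin m)) ∈ K → Commute (f i) (f j)) (i : Fin m) :
    lift f hf (gen K i) = f i := PresentedGroup.toGroup.of _

theorem closure_range_gen : Subgroup.closure (Set.range (gen K)) = ⊤ :=
  PresentedGroup.closure_range_of _

theorem hom_ext {H : Type*} [Group H] {f g : RAAG m K →* H} (h : ∀ i, f (gen K i) = g (gen K i)) :
    f = g := PresentedGroup.ext h

/-- Induction principle: a property of elements of a right-angled Artin group that is preserved
under left multiplication by generators and their inverses holds for all elements. -/
theorem induction_left {P : RAAG m K → Prop} (one : P 1)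
    (gen_mul : ∀ i g, P g → P (gen K i * g))
    (inv_gen_mul : ∀ i g, P g → P ((gen K i)⁻¹ * g)) (g : RAAG m K) : P g := by
  have hg : g ∈ Subgroup.closure (Set.range (gen K)) := by
    rw [closure_range_gen]; trivial
  induction hg using Subgroup.closure_induction_left with
  | one => exact one
  | mul_left x hx y hy ih => obtain ⟨i, rfl⟩ := hx; exact gen_mul i _ ih
  | inv_mul_cancel x hx y hy ih => obtain ⟨i, rfl⟩ := hx; exact inv_gen_mul i _ ih

/-- The exponent vector of an element of a right-angled Artin group. -/
def exponents (K : Finset (Finset (Fin m))) : RAAG m K →* Multiplicative (Fin m → ℤ) :=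
  lift (fun i => Multiplicative.ofAdd (Pi.single i 1)) fun _ _ _ _ => Commute.all _ _

theorem ker_exponents : (exponents K).ker = commutator (RAAG m K) := by
  refine le_antisymm (fun g hg => ?_) (Abelianization.commutator_subset_ker _)
  let ψ : Multiplicative (Fin m → ℤ) →* Abelianization (RAAG m K) :=
    { toFun := fun d => ∏ j, Abelianization.of (gen K j) ^ (Multiplicative.toAdd d j)
      map_one' := by simp
      map_mul' := fun a b => by simp [zpow_add, Finset.prod_mul_distrib] }
  have hψ : ψ.comp (exponents K) = Abelianization.of := by
    refine hom_ext fun i => ?_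
    simp only [MonoidHom.comp_apply, exponents, lift_gen]
    simp only [ψ, MonoidHom.coe_mk, OneHom.coe_mk, toAdd_ofAdd]
    rw [Finset.prod_eq_single i] <;> simp +contextual
  have h1 : Abelianization.of g = 1 := by
    rw [← hψ, MonoidHom.comp_apply, MonoidHom.mem_ker.mp hg, map_one]
  rw [← Abelianization.ker_of]
  exact h1

/-- The element `g₁ ^ d₁ ⋯ gₘ ^ dₘ` of a right-angled Artin group. -/
def monomial (K : Finset (Finset (Fin m))) (d : Fin m → ℤ) : RAAG m K :=
  ((List.finRange m).map fun j => gen K j ^ d j).prod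

@[simp] theorem monomial_zero : monomial K 0 = 1 := by
  simp [monomial]

theorem monomial_single (i : Fin m) : monomial K (Pi.single i 1) = gen K i := by
  have key : ∀ l : List (Fin m), l.Nodup →
      (l.map fun j => gen K j ^ (Pi.single i 1 : Fin m → ℤ) j).prod =
        if i ∈ l then gen K i else 1 := by
    intro l
    induction l with
    | nil => simp
    | cons a l ih =>
      intro hl
      rw [List.nodup_cons] at hl
      rw [List.map_cons, List.prod_cons, ih hl.2]
      rcases eq_or_ne a i with rfl | h
      · simp [hl.1]
      · simp [h, h.symm]
  rw [monomial, key _ (List.nodup_finRange m), if_pos (List.mem_finRange i)]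

theorem _root_.List.prod_map_mul_of_commute {ι M : Type*} [Monoid M] {f g : ι → M}
    (h : ∀ i j, Commute (f i) (g j)) (l : List ι) :
    (l.map fun i => f i * g i).prod = (l.map f).prod * (l.map g).prod := by
  induction l with
  | nil => simp
  | cons a l ih =>
    have hc : Commute (l.map f).prod (g a) := by
      refine Commute.list_prod_left _ _ fun x hx => ?_
      obtain ⟨i, -, rfl⟩ := List.mem_map.mp hx
      exact h i a
    simp only [List.map_cons, List.prod_cons, ih]
    rw [mul_assoc, ← mul_assoc (g a), ← hc.eq]
    simp only [mul_assoc]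

theorem monomial_add (hdown : ∀ I ∈ K, ∀ J ⊆ I, J ∈ K) {I : Finset (Fin m)} (hI : I ∈ K)
    {a b : Fin m → ℤ} (ha : ∀ k ∉ I, a k = 0) (hb : ∀ k ∉ I, b k = 0) :
    monomial K (a + b) = monomial K a * monomial K b := by
  simp only [monomial, Pi.add_apply, zpow_add]
  refine List.prod_map_mul_of_commute (fun i j => ?_) _
  by_cases hi : i ∈ I
  · by_cases hj : j ∈ I
    · rcases eq_or_ne i j with rfl | hij
      · exact (Commute.refl _).zpow_zpow _ _
      · refine (commute_gen hij (hdown I hI _ ?_)).zpow_zpow _ _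
        simp [Finset.insert_subset_iff, hi, hj]
    · simp [hb j hj]
  · simp [ha i hi]

end RAAG

/-- The defining conditions of a simplicial complex on the vertex set `Fin m`. -/
class IsSimplicialComplex {m : ℕ} (K : Finset (Finset (Fin m))) : Prop where
  down : ∀ I ∈ K, ∀ J ⊆ I, J ∈ K
  empty : ∅ ∈ K
  single : ∀ i, {i} ∈ K

namespace realPolyhedralProduct

variable {m : ℕ} {K : Finset (Finset (Fin m))}

/-- Two points lie in a common flat: they agree and are integral off a face of `K`. -/
def Adj (x y : realPolyhedralProduct m K) : Prop :=
  ∃ I ∈ K, ∀ k, k ∉ I → x.1 k = y.1 k ∧ ∃ n : ℤ, x.1 k = n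

/-- Paths with the same endpoints in a common star-convex subset are homotopic. -/
theorem homotopic_of_starConvex {W : Set (Fin m → ℝ)} {c : Fin m → ℝ} (hW : StarConvex ℝ c W)
    (hWK : ∀ y ∈ W, ∃ I ∈ K, ∀ k, k ∉ I → ∃ n : ℤ, y k = n)
    {x y : realPolyhedralProduct m K} (p q : Path x y)
    (hp : ∀ t, (p t).1 ∈ W) (hq : ∀ t, (q t).1 ∈ W) : p.Homotopic q := by
  have hx : x.1 ∈ W := by simpa using hp 0
  have hy : y.1 ∈ W := by simpa using hp 1
  have := hW.contractibleSpace ⟨_, hx⟩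
  let f : C(W, realPolyhedralProduct m K) := ⟨fun w => ⟨w.1, hWK _ w.2⟩, by fun_prop⟩
  let lift (r : Path x y) (hr : ∀ t, (r t).1 ∈ W) : Path (⟨x.1, hx⟩ : W) ⟨y.1, hy⟩ :=
    { toFun := fun t => ⟨(r t).1, hr t⟩
      continuous_toFun := by fun_prop
      source' := by simp
      target' := by simp }
  have h := (SimplyConnectedSpace.paths_homotopic (lift p hp) (lift q hq)).map f
  exact h

theorem Adj.exists_face {x y : realPolyhedralProduct m K} (h : Adj x y) (t : ℝ) :
    ∃ I ∈ K, ∀ k, k ∉ I → ∃ n : ℤ, AffineMap.lineMap x.1 y.1 t k = n := by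
  obtain ⟨I, hI, h⟩ := h
  refine ⟨I, hI, fun k hk => ?_⟩
  obtain ⟨h1, n, h2⟩ := h k hk
  refine ⟨n, ?_⟩
  rw [AffineMap.pi_lineMap_apply, ← h1, AffineMap.lineMap_same_apply, h2]

/-- The straight path between two points in a common flat. -/
def linePath {x y : realPolyhedralProduct m K} (h : Adj x y) : Path x y where
  toFun t := ⟨AffineMap.lineMap x.1 y.1 (t : ℝ), h.exists_face t⟩
  continuous_toFun := by
    refine Continuous.subtype_mk ?_ _
    exact AffineMap.lineMap_continuous.comp continuous_subtype_val
  source' := by simp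
  target' := by simp

/-- The homotopy class of the straight path between two points in a common flat. -/
def line {x y : realPolyhedralProduct m K} (h : Adj x y) : Path.Homotopic.Quotient x y :=
  .mk (linePath h)

theorem linePath_apply_eq {x y : realPolyhedralProduct m K} (h : Adj x y) {k : Fin m}
    (hk : x.1 k = y.1 k) (t : unitInterval) : (linePath h t).1 k = y.1 k := by
  change AffineMap.lineMap x.1 y.1 (t : ℝ) k = _
  rw [AffineMap.pi_lineMap_apply, ← hk, AffineMap.lineMap_same_apply]

theorem line_self {x : realPolyhedralProduct m K} (h : Adj x x) :
    line h = Path.Homotopic.Quotient.refl x := by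
  refine congrArg Path.Homotopic.Quotient.mk ?_
  ext t k
  exact linePath_apply_eq h rfl t

theorem line_trans_line {I : Finset (Fin m)} (hI : I ∈ K) {x y z : realPolyhedralProduct m K}
    (hx : ∀ k, k ∉ I → x.1 k = z.1 k) (hy : ∀ k, k ∉ I → y.1 k = z.1 k)
    (hz : ∀ k, k ∉ I → ∃ n : ℤ, z.1 k = n)
    (hxy : Adj x y) (hyz : Adj y z) (hxz : Adj x z) :
    (line hxy).trans (line hyz) = line hxz := by
  rw [line, line, line, ← Path.Homotopic.Quotient.mk_trans, Path.Homotopic.Quotient.eq]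
  let W : Set (Fin m → ℝ) := {w | ∀ k, k ∉ I → w k = z.1 k}
  have hW : StarConvex ℝ z.1 W := by
    intro w hw a b ha hb hab k hk
    simp only [Pi.add_apply, Pi.smul_apply, smul_eq_mul, hw k hk]
    rw [← add_mul, hab, one_mul]
  refine homotopic_of_starConvex hW (fun w hw => ⟨I, hI, fun k hk => ?_⟩) _ _
    (fun t => ?_) (fun t => ?_)
  · rw [hw k hk]; exact hz k hk
  · intro k hk
    rw [Path.trans_apply]
    split_ifs
    · rw [linePath_apply_eq hxy ((hx k hk).trans (hy k hk).symm), hy k hk]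
    · rw [linePath_apply_eq hyz (hy k hk)]
  · intro k hk
    rw [linePath_apply_eq hxz (hx k hk)]

/-- The open star of a lattice point. -/
def star (K : Finset (Finset (Fin m))) (n : Fin m → ℤ) : Set (realPolyhedralProduct m K) :=
  {x | ∀ j, |x.1 j - n j| < 1}

theorem isOpen_star (n : Fin m → ℤ) : IsOpen (star K n) := by
  have : star K n = ⋂ j, {x : realPolyhedralProduct m K | |x.1 j - n j| < 1} := by ext; simp [star]
  rw [this]
  refine isOpen_iInter_of_finite fun j => isOpen_lt ?_ continuous_const
  exact (((continuous_apply j).comp continuous_subtype_val).sub continuous_const).abs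

theorem eq_of_mem_star {n : Fin m → ℤ} {x : realPolyhedralProduct m K} (hx : x ∈ star K n)
    {k : Fin m} {a : ℤ} (ha : x.1 k = a) : n k = a := by
  have h := hx k
  rw [ha] at h
  have h' : |a - n k| < 1 := by exact_mod_cast h
  have := Int.abs_lt_one_iff.mp h'
  omega

theorem mem_star_floor (x : realPolyhedralProduct m K) : x ∈ star K fun j => ⌊x.1 j⌋ := by
  intro j
  rw [Int.self_sub_floor, Int.abs_fract]
  exact Int.fract_lt_one _

theorem sub_eq_zero_of_mem_star {n n' : Fin m → ℤ} {x : realPolyhedralProduct m K}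
    (hx : x ∈ star K n) (hx' : x ∈ star K n') {k : Fin m} (hk : ∃ a : ℤ, x.1 k = a) :
    (n' - n) k = 0 := by
  obtain ⟨a, ha⟩ := hk
  rw [Pi.sub_apply, eq_of_mem_star hx ha, eq_of_mem_star hx' ha, sub_self]

variable [IsSimplicialComplex K]

/-- The lattice points as vertices of the polyhedral product. -/
def vertex (K : Finset (Finset (Fin m))) [IsSimplicialComplex K] (n : Fin m → ℤ) :
    realPolyhedralProduct m K :=
  ⟨fun k => n k, ∅, IsSimplicialComplex.empty, fun k _ => ⟨n k, rfl⟩⟩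

theorem adj_vertex {I : Finset (Fin m)} (hI : I ∈ K) {a b : Fin m → ℤ}
    (h : ∀ k, k ∉ I → a k = b k) : Adj (vertex K a) (vertex K b) :=
  ⟨I, hI, fun k hk => ⟨congrArg Int.cast (h k hk), a k, rfl⟩⟩

theorem vertex_mem_star_iff {n a : Fin m → ℤ} : vertex K a ∈ star K n ↔ n = a := by
  refine ⟨fun h => funext fun k => eq_of_mem_star h rfl, ?_⟩
  rintro rfl j
  simp [vertex]

theorem adj_of_mem_star {n : Fin m → ℤ} {x : realPolyhedralProduct m K} (hx : x ∈ star K n) :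
    Adj x (vertex K n) := by
  obtain ⟨I, hI, h⟩ := x.2
  refine ⟨I, hI, fun k hk => ?_⟩
  obtain ⟨a, ha⟩ := h k hk
  exact ⟨by rw [ha, ← eq_of_mem_star hx ha]; rfl, a, ha⟩

theorem starConvex_star (n : Fin m → ℤ) :
    StarConvex ℝ (vertex K n).1 (Subtype.val '' star K n) := by
  rintro _ ⟨x, hx, rfl⟩ a b ha hb hab
  have hl : a • (vertex K n).1 + b • x.1 = AffineMap.lineMap x.1 (vertex K n).1 a := by
    rw [AffineMap.lineMap_apply_module, ← hab]; simp [add_comm]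
  refine ⟨⟨a • (vertex K n).1 + b • x.1, ?_⟩, fun j => ?_, rfl⟩
  · rw [hl]; exact (adj_of_mem_star hx).exists_face a
  · have : (a • (vertex K n).1 + b • x.1) j - n j = b * (x.1 j - n j) := by
      obtain rfl : a = 1 - b := by linarith
      simp [vertex]; ring
    rw [this, abs_mul, abs_of_nonneg hb]
    have := hx j
    have hb1 : b ≤ 1 := by linarith
    nlinarith [abs_nonneg (x.1 j - n j)]

theorem linePath_mem_star {n : Fin m → ℤ} {x : realPolyhedralProduct m K} (hx : x ∈ star K n)
    (t : unitInterval) : linePath (adj_of_mem_star hx) t ∈ star K n := by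
  obtain ⟨y, hy, hyx⟩ := (starConvex_star n) ⟨x, hx, rfl⟩ t.2.1 (sub_nonneg.mpr t.2.2)
    (by ring)
  convert hy
  refine Subtype.ext ?_
  rw [hyx]
  change AffineMap.lineMap x.1 (vertex K n).1 (t : ℝ) = _
  rw [AffineMap.lineMap_apply_module, add_comm]

/-- A path in an open star, followed by the straight path to the centre, is homotopic to the
straight path. -/
theorem mk_trans_line {n : Fin m → ℤ} {x y : realPolyhedralProduct m K} (p : Path x y)
    (hp : ∀ t, p t ∈ star K n) (hx : x ∈ star K n) (hy : y ∈ star K n) :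
    (Path.Homotopic.Quotient.mk p).trans (line (adj_of_mem_star hy)) =
      line (adj_of_mem_star hx) := by
  rw [line, line, ← Path.Homotopic.Quotient.mk_trans, Path.Homotopic.Quotient.eq]
  refine homotopic_of_starConvex (starConvex_star n) ?_ _ _ (fun t => ?_)
    fun t => ⟨_, linePath_mem_star hx t, rfl⟩
  · rintro _ ⟨w, -, rfl⟩
    exact w.2
  · refine ⟨_, ?_, rfl⟩
    rw [Path.trans_apply]
    split_ifs
    · exact hp _
    · exact linePath_mem_star hy _

/-- Homotopy classes of paths from the origin to lattice points. -/
abbrev VertexPath (K : Finset (Finset (Fin m))) [IsSimplicialComplex K] : Type :=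
  Σ n : Fin m → ℤ, Path.Homotopic.Quotient (vertex K 0) (vertex K n)

namespace VertexPath

/-- Prolong a path class by a straight path to another lattice point of a common flat. -/
def prolong (s : VertexPath K) (a : Fin m → ℤ) (h : Adj (vertex K s.1) (vertex K a)) :
    VertexPath K :=
  ⟨a, s.2.trans (line h)⟩

theorem prolong_self (s : VertexPath K) {a : Fin m → ℤ} (h : Adj (vertex K s.1) (vertex K a))
    (ha : a = s.1) : s.prolong a h = s := by
  subst ha
  rw [prolong, line_self, Path.Homotopic.Quotient.trans_refl]

theorem prolong_prolong (s : VertexPath K) {a b : Fin m → ℤ} {I : Finset (Fin m)} (hI : I ∈ K)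
    (hs : ∀ k, k ∉ I → s.1 k = b k) (h : Adj (vertex K s.1) (vertex K a))
    (ha : ∀ k, k ∉ I → (s.prolong a h).1 k = b k)
    (h' : Adj (vertex K (s.prolong a h).1) (vertex K b)) :
    (s.prolong a h).prolong b h' = s.prolong b (adj_vertex hI hs) := by
  refine congrArg (Sigma.mk b) ((Path.Homotopic.Quotient.trans_assoc _ _ _).trans ?_)
  refine congrArg s.2.trans ?_
  exact line_trans_line hI (fun k hk => congrArg Int.cast (hs k hk))
    (fun k hk => congrArg Int.cast (ha k hk)) (fun k _ => ⟨b k, rfl⟩) _ _ _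

theorem prolong_congr (s : VertexPath K) {a b : Fin m → ℤ} (hab : a = b)
    (h : Adj (vertex K s.1) (vertex K a)) :
    s.prolong a h = s.prolong b (hab ▸ h) := by
  subst hab; rfl

theorem adj_add_single (n : Fin m → ℤ) (i : Fin m) (z : ℤ) :
    Adj (vertex K n) (vertex K (n + Pi.single i z)) :=
  adj_vertex (IsSimplicialComplex.single i) fun k hk => by
    simp [Finset.mem_singleton.not.mp hk]

/-- Prolong a path class along the `i`-th coordinate direction. -/
def step (i : Fin m) (z : ℤ) (s : VertexPath K) : VertexPath K :=
  s.prolong (s.1 + Pi.single i z) (adj_add_single s.1 i z)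

theorem step_step_self (i : Fin m) (z w : ℤ) (s : VertexPath K) :
    step i z (step i w s) = step i (w + z) s := by
  refine (prolong_prolong s (IsSimplicialComplex.single i) ?_ _ ?_ _).trans
    (prolong_congr _ ?_ _)
  · intro k hk; simp [step, prolong, Finset.mem_singleton.not.mp hk]
  · intro k hk; simp [step, prolong, Finset.mem_singleton.not.mp hk]
  · simp [step, prolong, add_assoc, Pi.single_add]

theorem step_zero (i : Fin m) (s : VertexPath K) : step i 0 s = s :=
  prolong_self _ _ (by simp)

theorem step_comm {i j : Fin m} (h : ({i, j} : Finset (Fin m)) ∈ K) (z w : ℤ)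
    (s : VertexPath K) : step i z (step j w s) = step j w (step i z s) := by
  have hne : ∀ k, k ∉ ({i, j} : Finset (Fin m)) → k ≠ i ∧ k ≠ j := by simp
  refine (prolong_prolong s h ?_ _ ?_ _).trans <|
    (prolong_congr _ ?_ _).trans (prolong_prolong s h ?_ _ ?_ _).symm
  · intro k hk; simp [step, prolong, hne k hk]
  · intro k hk; simp [step, prolong, hne k hk]
  · exact add_right_comm _ _ _
  · intro k hk; simp [step, prolong, hne k hk]
  · intro k hk; simp [step, prolong, hne k hk]

/-- The permutation of `VertexPath K` prolonging paths by an edge. -/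
def stepPerm (K : Finset (Finset (Fin m))) [IsSimplicialComplex K] (i : Fin m) :
    Equiv.Perm (VertexPath K) where
  toFun := step i 1
  invFun := step i (-1)
  left_inv s := by rw [step_step_self]; exact step_zero i s
  right_inv s := by rw [step_step_self]; exact step_zero i s

/-- The action of the right-angled Artin group on path classes by prolongation along edges. -/
def action (K : Finset (Finset (Fin m))) [IsSimplicialComplex K] :
    RAAG m K →* Equiv.Perm (VertexPath K) :=
  RAAG.lift (stepPerm K) fun _ _ _ h => Equiv.ext fun s => step_comm h 1 1 s

theorem action_gen (i : Fin m) (s : VertexPath K) :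
    action K (RAAG.gen K i) s = step i 1 s :=
  DFunLike.congr_fun (RAAG.lift_gen (K := K) (stepPerm K) _ i) s

/-- A generator-equivariant map into a set with an action of the group is equivariant. -/
theorem equivariant_of_gen {T : Type*} (α : RAAG m K →* Equiv.Perm T) (f : VertexPath K → T)
    (hf : ∀ i s, f (action K (RAAG.gen K i) s) = α (RAAG.gen K i) (f s)) (g : RAAG m K)
    (s : VertexPath K) : f (action K g s) = α g (f s) := by
  induction g using RAAG.induction_left with
  | one => simp
  | gen_mul i g ih => rw [map_mul, Equiv.Perm.mul_apply, hf, ih, map_mul, Equiv.Perm.mul_apply]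
  | inv_gen_mul i g ih =>
    rw [map_mul, map_mul, Equiv.Perm.mul_apply, Equiv.Perm.mul_apply, ← ih, map_inv, map_inv,
      Equiv.Perm.eq_inv_iff_eq, ← hf, ← Equiv.Perm.mul_apply, mul_inv_cancel, Equiv.Perm.one_apply]

theorem action_fst (g : RAAG m K) (s : VertexPath K) :
    (action K g s).1 = Multiplicative.toAdd (RAAG.exponents K g) + s.1 := by
  let β : Multiplicative (Fin m → ℤ) →* Equiv.Perm (Fin m → ℤ) :=
    { toFun := fun d => Equiv.addLeft d.toAdd
      map_one' := by ext; simp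
      map_mul' := fun a b => by ext; simp }
  refine equivariant_of_gen (β.comp (RAAG.exponents K)) Sigma.fst (fun i s => ?_) g s
  rw [action_gen, MonoidHom.comp_apply, RAAG.exponents, RAAG.lift_gen]
  exact add_comm _ _

theorem action_loop_trans (g : RAAG m K)
    (c : Path.Homotopic.Quotient (vertex K 0) (vertex K 0)) (s : VertexPath K) :
    (⟨(action K g s).1, c.trans (action K g s).2⟩ : VertexPath K) =
      action K g ⟨s.1, c.trans s.2⟩ := by
  refine equivariant_of_gen (action K) (fun s => ⟨s.1, c.trans s.2⟩) (fun i s => ?_) g s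
  rw [action_gen, action_gen]
  simp only [step, prolong, Path.Homotopic.Quotient.trans_assoc]

theorem exists_action_eq_step (i : Fin m) (z : ℤ) (s : VertexPath K) :
    ∃ g, action K g s = step i z s := by
  induction z using Int.induction_on with
  | zero => exact ⟨1, by rw [step_zero, map_one, Equiv.Perm.one_apply]⟩
  | succ z ih =>
    obtain ⟨g, hg⟩ := ih
    exact ⟨RAAG.gen K i * g, by
      rw [map_mul, Equiv.Perm.mul_apply, hg, action_gen, step_step_self]⟩
  | pred z ih =>
    obtain ⟨g, hg⟩ := ih
    exact ⟨(RAAG.gen K i)⁻¹ * g, by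
      rw [map_mul, Equiv.Perm.mul_apply, hg, map_inv, Equiv.Perm.inv_eq_iff_eq, action_gen,
        step_step_self, sub_add_cancel]⟩

theorem exists_action_eq_prolong {I : Finset (Fin m)} (hI : I ∈ K) (s : VertexPath K)
    (a : Fin m → ℤ) (h : ∀ k, k ∉ I → s.1 k = a k) :
    ∃ g, action K g s = s.prolong a (adj_vertex hI h) := by
  suffices H : ∀ J : Finset (Fin m), J ⊆ I → ∀ (a : Fin m → ℤ) (h : ∀ k, k ∉ J → s.1 k = a k)
      (h' : Adj (vertex K s.1) (vertex K a)), ∃ g, action K g s = s.prolong a h' from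
    H I subset_rfl a h _
  intro J
  induction J using Finset.induction_on with
  | empty =>
    intro _ a h h'
    exact ⟨1, by
      rw [prolong_self s h' (funext fun k => (h k (Finset.notMem_empty k)).symm), map_one,
        Equiv.Perm.one_apply]⟩
  | insert j J _ ih =>
    intro hJ a h h'
    have hJI : J ⊆ I := (Finset.subset_insert j J).trans hJ
    have hj : j ∈ I := hJ (Finset.mem_insert_self j J)
    let b := Function.update a j (s.1 j)
    have hb : ∀ k, k ∉ J → s.1 k = b k := by
      intro k hk
      rcases eq_or_ne k j with rfl | hkj
      · simp [b]
      · simpa [b, hkj] using h k (by simp [hkj, hk])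
    have hsb : Adj (vertex K s.1) (vertex K b) :=
      adj_vertex hI fun k hk => hb k fun hk' => hk (hJI hk')
    obtain ⟨g₁, hg₁⟩ := ih hJI b hb hsb
    obtain ⟨g₂, hg₂⟩ := exists_action_eq_step j (a j - s.1 j) (s.prolong b hsb)
    refine ⟨g₂ * g₁, ?_⟩
    have hba : b + Pi.single j (a j - s.1 j) = a := by
      ext k
      rcases eq_or_ne k j with rfl | hkj
      · simp [b]
      · simp [b, hkj]
    have hsI : ∀ k, k ∉ I → s.1 k = a k := fun k hk => h k fun hk' => hk (hJ hk')
    rw [map_mul, Equiv.Perm.mul_apply, hg₁, hg₂]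
    refine (prolong_congr _ hba _).trans (prolong_prolong s hI hsI _ ?_ _)
    intro k hk
    have : k ≠ j := fun e => hk (e ▸ hj)
    simp [prolong, b, this]

/-- The trivial path class. -/
def base (K : Finset (Finset (Fin m))) [IsSimplicialComplex K] : VertexPath K :=
  ⟨0, .refl _⟩

/-- The path class obtained by completing a path ending in an open star by a straight path to
the centre. -/
def complete {x : realPolyhedralProduct m K} (c : Path.Homotopic.Quotient (vertex K 0) x)
    (n : Fin m → ℤ) (hx : x ∈ star K n) : VertexPath K :=
  ⟨n, c.trans (line (adj_of_mem_star hx))⟩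

theorem exists_action_complete {x : realPolyhedralProduct m K}
    (c : Path.Homotopic.Quotient (vertex K 0) x) (n n' : Fin m → ℤ) (hx : x ∈ star K n)
    (hx' : x ∈ star K n') : ∃ g, action K g (complete c n hx) = complete c n' hx' := by
  obtain ⟨I, hI, h⟩ := x.2
  have hn : ∀ k, k ∉ I → n k = n' k ∧ x.1 k = n' k := by
    intro k hk
    obtain ⟨a, ha⟩ := h k hk
    rw [eq_of_mem_star hx ha, eq_of_mem_star hx' ha]
    exact ⟨rfl, ha⟩
  obtain ⟨g, hg⟩ := exists_action_eq_prolong hI (complete c n hx) n' fun k hk => (hn k hk).1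
  refine ⟨g, hg.trans ?_⟩
  refine congrArg (Sigma.mk n') ((Path.Homotopic.Quotient.trans_assoc _ _ _).trans ?_)
  refine congrArg c.trans ?_
  exact line_trans_line hI (fun k hk => (hn k hk).2)
    (fun k hk => congrArg Int.cast (hn k hk).1) (fun k _ => ⟨n' k, rfl⟩) _ _ _

theorem complete_of_eq {a : Fin m → ℤ} {x : realPolyhedralProduct m K}
    (c : Path.Homotopic.Quotient (vertex K 0) x) (hxa : x = vertex K a) (hx : x ∈ star K a) :
    complete c a hx = ⟨a, c.cast rfl hxa.symm⟩ := by
  subst hxa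
  rw [complete, line_self, Path.Homotopic.Quotient.trans_refl,
    Path.Homotopic.Quotient.cast_rfl_rfl]

theorem mk_subpath_cast {X : Type*} [TopologicalSpace X] {x y x₀ : X} (γ : Path x y)
    (h : x₀ = γ 0) (t s : unitInterval) :
    Path.Homotopic.Quotient.mk ((γ.subpath 0 s).cast h rfl) =
      (Path.Homotopic.Quotient.mk ((γ.subpath 0 t).cast h rfl)).trans (.mk (γ.subpath t s)) := by
  subst h
  rw [← Path.Homotopic.Quotient.mk_trans, Path.Homotopic.Quotient.eq]
  exact ⟨(Path.Homotopy.subpathTransSubpath γ 0 t s).symm⟩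

/-- Every path class is obtained from the trivial one by the action. -/
theorem exists_action_base (s : VertexPath K) : ∃ g, action K g (base K) = s := by
  obtain ⟨n, c⟩ := s
  induction c using Path.Homotopic.Quotient.ind with | mk γ
  let c (t : unitInterval) : Path.Homotopic.Quotient (vertex K 0) (γ t) :=
    .mk ((γ.subpath 0 t).cast γ.source.symm rfl)
  let Good (t : unitInterval) : Prop :=
    ∃ (n : Fin m → ℤ) (hn : γ t ∈ star K n) (g : RAAG m K),
      action K g (base K) = complete (c t) n hn
  have good_iff : ∀ {t n} (hn : γ t ∈ star K n),
      Good t ↔ ∃ g : RAAG m K, action K g (base K) = complete (c t) n hn := by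
    refine fun {t n} hn => ⟨?_, fun ⟨g, hg⟩ => ⟨n, hn, g, hg⟩⟩
    rintro ⟨n', hn', g, hg⟩
    obtain ⟨g', hg'⟩ := exists_action_complete (c t) n' n hn' hn
    exact ⟨g' * g, by rw [map_mul, Equiv.Perm.mul_apply, hg, hg']⟩
  have hloc : ∀ t, ∀ᶠ s in 𝓝 t, (Good t ↔ Good s) := by
    intro t
    obtain ⟨n, hn⟩ : ∃ n, γ t ∈ star K n := ⟨_, mem_star_floor _⟩
    have hU : γ ⁻¹' star K n ∈ 𝓝 t := ((isOpen_star n).preimage γ.continuous).mem_nhds hn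
    obtain ⟨ε, hε, hεU⟩ := Metric.mem_nhds_iff.mp hU
    have hVo : (Subtype.val ⁻¹' Metric.ball (t : ℝ) ε : Set unitInterval).OrdConnected :=
      (convex_ball _ _).ordConnected.preimage_mono fun _ _ h => h
    filter_upwards [Metric.ball_mem_nhds t hε] with s hs
    have hsub : ∀ u, γ.subpath t s u ∈ star K n := by
      intro u
      have : γ.subpath t s u ∈ γ '' Set.uIcc t s := by
        rw [← Path.range_subpath]; exact ⟨u, rfl⟩
      obtain ⟨v, hv, hvu⟩ := this
      rw [← hvu]
      exact hεU (hVo.uIcc_subset (Metric.mem_ball_self hε) hs hv)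
    have hcs : complete (c s) n (hεU hs) = complete (c t) n hn := by
      have h1 : c s = (c t).trans (.mk (γ.subpath t s)) := mk_subpath_cast γ γ.source.symm t s
      rw [complete, complete, h1, Path.Homotopic.Quotient.trans_assoc,
        mk_trans_line _ hsub hn (hεU hs)]
    rw [good_iff hn, good_iff (hεU hs), hcs]
  have hall : Good 0 ↔ Good 1 :=
    PreconnectedSpace.induction₂' (fun t s => Good t ↔ Good s)
      (fun t => (hloc t).mono fun s h => ⟨h, h.symm⟩) ⟨fun _ _ _ => Iff.trans⟩ 0 1
  have h0 : Good 0 := by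
    refine ⟨0, ?_, 1, ?_⟩
    · rw [γ.source]; exact vertex_mem_star_iff.mpr rfl
    · rw [complete_of_eq _ γ.source, map_one, Equiv.Perm.one_apply]
      refine congrArg (Sigma.mk 0) ?_
      rw [← Path.Homotopic.Quotient.mk_cast, ← Path.Homotopic.Quotient.mk_refl]
      congr 1
      ext t
      simp
  have h1 : γ 1 ∈ star K n := by rw [γ.target]; exact vertex_mem_star_iff.mpr rfl
  obtain ⟨g, hg⟩ := (good_iff h1).mp (hall.mp h0)
  refine ⟨g, hg.trans ?_⟩
  rw [complete_of_eq _ γ.target, ← Path.Homotopic.Quotient.mk_cast]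
  congr 2
  ext t
  simp

end VertexPath

/-- The discrete topology on a right-angled Artin group, the fibre of the covering below. -/
instance : TopologicalSpace (RAAG m K) := ⊥

instance : DiscreteTopology (RAAG m K) := ⟨rfl⟩

/-- The cocycle of a covering of the polyhedral product with fibre the right-angled Artin group,
trivial over open stars. -/
def coveringCore (K : Finset (Finset (Fin m))) [IsSimplicialComplex K] :
    FiberBundleCore (Fin m → ℤ) (realPolyhedralProduct m K) (RAAG m K) where
  baseSet := star K
  isOpen_baseSet := isOpen_star
  indexAt x := fun j => ⌊x.1 j⌋
  mem_baseSet_at := mem_star_floor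
  coordChange n n' _ g := RAAG.monomial K (n' - n) * g
  coordChange_self n x _ g := by rw [sub_self, RAAG.monomial_zero, one_mul]
  continuousOn_coordChange n n' :=
    ((continuous_of_discreteTopology (f := fun g => RAAG.monomial K (n' - n) * g)).comp
      continuous_snd).continuousOn
  coordChange_comp n n' n'' x hx g := by
    obtain ⟨I, hI, h⟩ := x.2
    rw [← mul_assoc, ← RAAG.monomial_add IsSimplicialComplex.down hI
      (fun k hk => sub_eq_zero_of_mem_star hx.1.2 hx.2 (h k hk))
      (fun k hk => sub_eq_zero_of_mem_star hx.1.1 hx.1.2 (h k hk)), sub_add_sub_cancel]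

theorem isCoveringMap_proj : IsCoveringMap (coveringCore K).proj :=
  FiberBundle.isCoveringMap (F := RAAG m K) (E := (coveringCore K).Fiber)

/-- The coordinate of a point of the covering in the chart over an open star. -/
def coord (n : Fin m → ℤ) {x : realPolyhedralProduct m K}
    (e : (coveringCore K).proj ⁻¹' {x}) : RAAG m K :=
  ((coveringCore K).localTriv n e.1).2

theorem coord_eq_monomial_mul {n n' : Fin m → ℤ} {x : realPolyhedralProduct m K}
    (hx : x ∈ star K n) (hx' : x ∈ star K n') (e : (coveringCore K).proj ⁻¹' {x}) :
    coord n' e = RAAG.monomial K (n' - n) * coord n e := by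
  obtain ⟨e, rfl⟩ := e
  exact ((coveringCore K).coordChange_comp _ n n' e.proj ⟨⟨mem_star_floor _, hx⟩, hx'⟩ e.2).symm

theorem coord_monodromy {n : Fin m → ℤ} {x y : realPolyhedralProduct m K} (p : Path x y)
    (hp : ∀ t, p t ∈ star K n) (e : (coveringCore K).proj ⁻¹' {x}) :
    coord n (isCoveringMap_proj.monodromy (.mk p) e) = coord n e := by
  let Γ := isCoveringMap_proj.liftPath p.toContinuousMap e.1 (p.source.trans e.2.symm)
  have hΓ : ∀ t, (coveringCore K).proj (Γ t) = p t := fun t =>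
    congr_fun (isCoveringMap_proj.liftPath_lifts ..) t
  have hcont : Continuous fun t => ((coveringCore K).localTriv n (Γ t)).2 := by
    refine continuous_snd.comp ?_
    refine ((coveringCore K).localTriv n).continuousOn_toFun.comp_continuous Γ.continuous ?_
    intro t
    rw [((coveringCore K).localTriv n).mem_source, hΓ]
    exact hp t
  have h01 := PreconnectedSpace.constant inferInstance hcont (x := 1) (y := 0)
  rw [show Γ 0 = e.1 from isCoveringMap_proj.liftPath_zero ..] at h01
  exact h01

theorem coord_monodromy_edge (n : Fin m → ℤ) (i : Fin m)
    (e : (coveringCore K).proj ⁻¹' {vertex K n}) :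
    coord (n + Pi.single i 1)
      (isCoveringMap_proj.monodromy (line (VertexPath.adj_add_single n i 1)) e) =
      RAAG.gen K i * coord n e := by
  have h := VertexPath.adj_add_single (K := K) n i 1
  let x := linePath h ⟨1 / 2, by norm_num, by norm_num⟩
  have hk : ∀ k, k ≠ i → x.1 k = ((n + Pi.single i 1 : Fin m → ℤ) k : ℝ) := fun k hk =>
    linePath_apply_eq h (by simp [vertex, hk]) _
  have hi : x.1 i = n i + 1 / 2 := by
    change AffineMap.lineMap (vertex K n).1 (vertex K (n + Pi.single i 1)).1 (1 / 2 : ℝ) i = _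
    rw [AffineMap.pi_lineMap_apply, AffineMap.lineMap_apply_ring']
    simp [vertex, add_comm]
  have hx : x ∈ star K n := by
    intro k
    rcases eq_or_ne k i with rfl | hki
    · rw [hi]; norm_num [abs_lt]
    · rw [hk k hki]; simp [hki]
  have hx' : x ∈ star K (n + Pi.single i 1) := by
    intro k
    rcases eq_or_ne k i with rfl | hki
    · rw [hi, Pi.add_apply, Pi.single_eq_same]
      push_cast
      rw [abs_lt]
      constructor <;> linarith
    · rw [hk k hki]; simp
  have hline : line h = (line (adj_of_mem_star hx)).symm.trans (line (adj_of_mem_star hx')) := by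
    rw [← line_trans_line (IsSimplicialComplex.single (K := K) i) (fun k hki => ?_)
      (fun k hki => ?_) (fun k _ => ⟨_, rfl⟩) (adj_of_mem_star hx) h (adj_of_mem_star hx'),
      ← Path.Homotopic.Quotient.trans_assoc, Path.Homotopic.Quotient.symm_trans,
      Path.Homotopic.Quotient.refl_trans]
    · exact hk k (Finset.notMem_singleton.mp hki)
    · simp [vertex, Finset.notMem_singleton.mp hki]
  have hsymm : ∀ t, (linePath (adj_of_mem_star hx)).symm t ∈ star K n := fun t =>
    linePath_mem_star hx _
  rw [hline, IsCoveringMap.monodromy_trans_apply]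
  refine (coord_monodromy _ (linePath_mem_star hx') _).trans ?_
  rw [coord_eq_monomial_mul hx hx', add_sub_cancel_left, RAAG.monomial_single]
  exact congrArg _ (coord_monodromy _ hsymm e)

/-- The holonomy of a path class from the origin to a lattice point. -/
def holonomy (s : VertexPath K) : RAAG m K :=
  coord s.1 (isCoveringMap_proj.monodromy s.2 ⟨⟨vertex K 0, (1 : RAAG m K)⟩, rfl⟩)

theorem holonomy_base : holonomy (VertexPath.base K) = 1 := by
  rw [holonomy, VertexPath.base, IsCoveringMap.monodromy_refl]
  change RAAG.monomial K (0 - fun j => ⌊((0 : ℤ) : ℝ)⌋) * 1 = 1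
  rw [mul_one, show (0 - fun j => ⌊((0 : ℤ) : ℝ)⌋ : Fin m → ℤ) = 0 by ext; simp,
    RAAG.monomial_zero]

theorem holonomy_action (g : RAAG m K) (s : VertexPath K) :
    holonomy (VertexPath.action K g s) = g * holonomy s := by
  refine VertexPath.equivariant_of_gen (MulAction.toPermHom _ _) holonomy (fun i s => ?_) g s
  rw [VertexPath.action_gen]
  refine Eq.trans ?_ (coord_monodromy_edge s.1 i _)
  rw [← IsCoveringMap.monodromy_trans_apply]
  rfl

theorem action_holonomy (s : VertexPath K) :
    VertexPath.action K (holonomy s) (VertexPath.base K) = s := by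
  obtain ⟨g, rfl⟩ := VertexPath.exists_action_base s
  rw [holonomy_action, holonomy_base, mul_one]

/-- The holonomy homomorphism from the fundamental group to the right-angled Artin group. -/
def holonomyHom (K : Finset (Finset (Fin m))) [IsSimplicialComplex K] :
    FundamentalGroup (realPolyhedralProduct m K) (vertex K 0) →* RAAG m K where
  toFun c := holonomy ⟨0, c⟩
  map_one' := holonomy_base
  map_mul' p q := by
    obtain ⟨g, hg⟩ := VertexPath.exists_action_base (K := K) ⟨0, p⟩
    have h := VertexPath.action_loop_trans g q (VertexPath.base K)
    rw [hg] at h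
    refine (congrArg holonomy h).trans ?_
    rw [holonomy_action, ← hg, holonomy_action, holonomy_base, mul_one]
    congr 2
    exact congrArg (Sigma.mk 0) (Path.Homotopic.Quotient.trans_refl q)

theorem holonomyHom_injective : Function.Injective (holonomyHom K) := by
  intro p q h
  have h1 := action_holonomy (K := K) ⟨0, p⟩
  have h2 := action_holonomy (K := K) ⟨0, q⟩
  rw [show holonomy ⟨0, p⟩ = holonomy ⟨0, q⟩ from h, h2] at h1
  exact (eq_of_heq (Sigma.mk.inj h1).2).symm

theorem range_holonomyHom : (holonomyHom K).range = commutator (RAAG m K) := by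
  rw [← RAAG.ker_exponents]
  ext g
  constructor
  · rintro ⟨c, rfl⟩
    have h := congrArg Sigma.fst (action_holonomy (K := K) ⟨0, c⟩)
    rw [VertexPath.action_fst] at h
    change RAAG.exponents K (holonomy ⟨0, c⟩) = 1
    simpa [VertexPath.base] using h
  · intro hg
    obtain ⟨⟨n, c⟩, hs⟩ : ∃ s, VertexPath.action K g (VertexPath.base K) = s := ⟨_, rfl⟩
    have h := VertexPath.action_fst g (VertexPath.base K)
    rw [hs, MonoidHom.mem_ker.mp hg] at h
    obtain rfl : n = 0 := by simpa [VertexPath.base] using h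
    refine ⟨c, ?_⟩
    change holonomy ⟨0, c⟩ = g
    rw [← hs, holonomy_action, holonomy_base, mul_one]

end realPolyhedralProduct

end

/-- The fundamental group of the polyhedral product `L_K = (ℝ, ℤ)^K` (based at the origin) is
isomorphic to the commutator subgroup `RAAG_K'` of the right-angled Artin group `RAAG_K`. -/
theorem fundamentalGroup_real_polyhedral_product (m : ℕ) (K : Finset (Finset (Fin m)))
    (hdown : ∀ I ∈ K, ∀ J ⊆ I, J ∈ K) (hempty : (∅ : Finset (Fin m)) ∈ K)
    (hsingle : ∀ i : Fin m, ({i} : Finset (Fin m)) ∈ K) :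
    Nonempty
      (FundamentalGroup (realPolyhedralProduct m K)
          ⟨fun _ => 0, ∅, hempty, fun _ _ => ⟨0, Int.cast_zero.symm⟩⟩ ≃*
        commutator (RAAG m K)) := by
  have : IsSimplicialComplex K := ⟨hdown, hempty, hsingle⟩
  have hbase : (⟨fun _ => 0, ∅, hempty, fun _ _ => ⟨0, Int.cast_zero.symm⟩⟩ :
      realPolyhedralProduct m K) = realPolyhedralProduct.vertex K 0 :=
    Subtype.ext (funext fun _ => Int.cast_zero.symm)
  rw [hbase]
  exact ⟨(MonoidHom.ofInjective realPolyhedralProduct.holonomyHom_injective).trans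
    (MulEquiv.subgroupCongr realPolyhedralProduct.range_holonomyHom)⟩
end
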